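/- Suppose r ≥ 1, n = r + 1, the columns of z generate ℤ^r (effective action), and every r-element subset of the columns of z is linearly independent over ℚ (so the column matroid of z is a circuit). Then the orbit space X_z is homeomorphic to the sphere S^{r+1}, i.e. to Metric.sphere (0 : EuclideanSpace ℝ (Fin (r+2))) 1. -/

import Mathlib

open scoped BigOperators

noncomputable section

/-- The sphere `S^{2n-1}`, realized as the unit sphere of `ℂ^n`. -/
abbrev Sph (n : ℕ) : Type := Metric.sphere (0 : EuclideanSpace ℂ (Fin n)) 1

/-- The element of the circle by which `t ∈ T^r = (Fin r → Circle)` acts on the `j`-th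
coordinate of `ℂ^n`, namely `∏ i, (t i) ^ (z i j)`. -/
def weightProd {n r : ℕ} (z : Fin r → Fin n → ℤ) (t : Fin r → Circle) (j : Fin n) : Circle :=
  ∏ i, t i ^ z i j

/-- The orbit equivalence relation on `S^{2n-1}` for the linear torus action with weight
matrix `z`:  `x ≈ y` iff some `t ∈ T^r` moves `x` to `y`, where `(t • x) j = (∏ i, (t i)^(z i j)) • (x j)`. -/
def orbitSetoid {n r : ℕ} (z : Fin r → Fin n → ℤ) : Setoid (Sph n) where
  r x y := ∃ t : Fin r → Circle,
    ∀ j, (weightProd z t j : ℂ) * (x : EuclideanSpace ℂ (Fin n)) j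
      = (y : EuclideanSpace ℂ (Fin n)) j
  iseqv := by
    constructor
    · intro x
      exact ⟨1, fun j => by simp [weightProd]⟩
    · rintro x y ⟨t, ht⟩
      refine ⟨fun i => (t i)⁻¹, fun j => ?_⟩
      have h : weightProd z (fun i => (t i)⁻¹) j = (weightProd z t j)⁻¹ := by
        simp only [weightProd, inv_zpow]
        exact Finset.prod_inv_distrib _
      rw [h, ← ht j, Circle.coe_inv, inv_mul_cancel_left₀ (Circle.coe_ne_zero _)]
    · rintro x y zz ⟨t, ht⟩ ⟨s, hs⟩
      refine ⟨t * s, fun j => ?_⟩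
      have h : weightProd z (t * s) j = weightProd z t j * weightProd z s j := by
        simp [weightProd, mul_zpow, Finset.prod_mul_distrib]
      rw [h, ← hs j, ← ht j]
      push_cast
      ring

/-- The orbit space `X_z = S^{2n-1}/T^r` of the linear torus action with weight matrix `z`,
equipped with the quotient topology. -/
abbrev OrbitSpace {n r : ℕ} (z : Fin r → Fin n → ℤ) : Type := Quotient (orbitSetoid z)


theorem zpow_sum_aux {G ι : Type*} [CommGroup G] (s : Finset ι) (f : ι → ℤ) (g : G) :
    g ^ (∑ i ∈ s, f i) = ∏ i ∈ s, g ^ f i := by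
  classical
  induction s using Finset.induction_on with
  | empty => simp
  | insert a s h ih => rw [Finset.sum_insert h, Finset.prod_insert h, zpow_add, ih]

theorem alg (r : ℕ) 
    (z : Fin r → Fin (r + 1) → ℤ)
    (heff : Submodule.span ℤ (Set.range fun j => fun i => z i j) = ⊤)
    (hind : ∀ s : Finset (Fin (r + 1)), s.card = r →
      LinearIndependent ℚ (fun j : s => fun i => (z i (j : Fin (r + 1)) : ℚ))) :
    ∃ a : Fin (r + 1) → ℤ, (∀ j, a j ≠ 0) ∧
      (∀ t, ∏ j, weightProd z t j ^ a j = 1) ∧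
      (∀ u : Fin (r+1) → Circle, ∏ j, u j ^ a j = 1 → ∃ t, ∀ j, weightProd z t j = u j) := by
  let Z : (Fin (r+1) → ℤ) →ₗ[ℤ] (Fin r → ℤ) := Matrix.mulVecLin (Matrix.of z)
  have hZ : ∀ w i, Z w i = ∑ j, z i j * w j := fun w i => by
    simp [Z, Matrix.mulVec, dotProduct]
  have hran : LinearMap.range Z = ⊤ := by
    rw [Matrix.range_mulVecLin, ← heff]; rfl
  have hsurj : Function.Surjective Z := LinearMap.range_eq_top.1 hran
  obtain ⟨S, hS⟩ := Module.projective_lifting_property Z LinearMap.id hsurj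
  have hS' : ∀ y, Z (S y) = y := fun y => LinearMap.congr_fun hS y
  have hk : Module.finrank ℤ (LinearMap.ker Z) = 1 := by
    have := Submodule.finrank_quotient_add_finrank (LinearMap.ker Z)
    rw [(Z.quotKerEquivOfSurjective hsurj).finrank_eq] at this
    simp at this
    omega
  let b := Module.finBasisOfFinrankEq ℤ (LinearMap.ker Z) hk
  set a : Fin (r+1) → ℤ := (b 0 : Fin (r+1) → ℤ) with ha
  have haZ : Z a = 0 := (b 0).2
  have ha0 : a ≠ 0 := by
    intro h
    exact b.ne_zero 0 (Subtype.ext h)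
  have hgen : ∀ w, Z w = 0 → ∃ c : ℤ, w = c • a := by
    intro w hw
    have := b.sum_repr ⟨w, hw⟩
    refine ⟨b.repr ⟨w, hw⟩ 0, ?_⟩
    have h2 := congrArg Subtype.val this
    simp at h2
    exact h2.symm
  refine ⟨a, ?_, ?_, ?_⟩
  · intro j hj
    apply ha0
    have hl := hind (Finset.univ.erase j) (by simp)
    rw [Fintype.linearIndependent_iff] at hl
    have h3 := hl (fun k => (a k : ℚ)) (by
      ext i
      have h4 : ∑ k, z i k * a k = 0 := by rw [← hZ, haZ]; rfl
      rw [← Finset.add_sum_erase _ _ (Finset.mem_univ j), hj, mul_zero, zero_add] at h4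
      have h5 := Finset.sum_coe_sort (Finset.univ.erase j) (fun k => (a k : ℚ) * (z i k : ℚ))
      simp only [Finset.sum_apply, Pi.smul_apply, smul_eq_mul, Pi.zero_apply]
      rw [h5]
      have h6 : ((∑ k ∈ Finset.univ.erase j, z i k * a k : ℤ) : ℚ) = 0 := by rw [h4]; simp
      push_cast at h6
      rw [← h6]
      exact Finset.sum_congr rfl fun k _ => mul_comm _ _)
    ext k
    by_cases hkj : k = j
    · rw [hkj, hj]; rfl
    · have := h3 ⟨k, by simp [hkj]⟩
      simpa using this
  · intro t
    simp only [weightProd]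
    simp_rw [← Finset.prod_zpow, ← zpow_mul]
    rw [Finset.prod_comm]
    refine Finset.prod_eq_one fun i _ => ?_
    rw [← zpow_sum_aux]
    have : ∑ j, z i j * a j = 0 := by rw [← hZ, haZ]; rfl
    rw [this, zpow_zero]
  · intro u hu
    refine ⟨fun i => ∏ k, u k ^ (S (Pi.single i 1) k), fun j => ?_⟩
    simp only [weightProd]
    simp_rw [← Finset.prod_zpow, ← zpow_mul]
    rw [Finset.prod_comm]
    simp_rw [← zpow_sum_aux]
    obtain ⟨c, hc⟩ := hgen (S (Z (Pi.single j 1)) - Pi.single j 1) (by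
      rw [map_sub, hS', sub_self])
    have key : ∀ k, ∑ i, S (Pi.single i 1) k * z i j = (Pi.single j 1 : Fin (r+1) → ℤ) k + a k * c := by
      intro k
      have h1 : (Z (Pi.single j 1)) = ∑ i, z i j • (Pi.single i 1 : Fin r → ℤ) := by
        ext i
        rw [hZ]
        simp [Pi.single_apply]
      have h2 := congrFun hc k
      rw [h1, map_sum] at h2
      simp only [map_smul, Pi.sub_apply, Finset.sum_apply, Pi.smul_apply, smul_eq_mul] at h2
      simp_rw [mul_comm _ (z _ j)]
      linarith
    simp_rw [key, zpow_add, zpow_mul, Finset.prod_mul_distrib, Finset.prod_zpow, hu]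
    rw [one_zpow, mul_one, Finset.prod_eq_single j]
    · simp
    · intro k _ hk; simp [hk]
    · simp

theorem circle_root (a : ℤ) (ha : a ≠ 0) (c : Circle) : ∃ u : Circle, u ^ a = c := by
  obtain ⟨θ, rfl⟩ := Circle.exp_surjective c
  refine ⟨Circle.exp (θ / a), ?_⟩
  rw [← Circle.exp_zsmul]
  congr 1
  have : (a : ℝ) ≠ 0 := by exact_mod_cast ha
  simp; field_simp

/-- affine coordinates on the simplex -/
def pcoord (r : ℕ) (v : Fin r → ℝ) : Fin (r+1) → ℝ := Fin.snoc v (1 - ∑ i, v i)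

theorem pcoord_sum (r : ℕ) (v : Fin r → ℝ) : ∑ j, pcoord r v j = 1 := by
  simp [pcoord, Fin.sum_univ_castSucc]

theorem pcoord_cont (r : ℕ) (j : Fin (r+1)) : Continuous fun v => pcoord r v j := by
  refine Fin.lastCases ?_ (fun i => ?_) j
  · simp only [pcoord, Fin.snoc_last]; fun_prop
  · simp only [pcoord, Fin.snoc_castSucc]; fun_prop

theorem pcoord_aff (r : ℕ) (j : Fin (r+1)) (v w : Fin r → ℝ) (a b : ℝ) (hab : a + b = 1) :
    pcoord r (a • v + b • w) j = a * pcoord r v j + b * pcoord r w j := by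
  refine Fin.lastCases ?_ (fun i => ?_) j
  · simp only [pcoord, Fin.snoc_last, Pi.add_apply, Pi.smul_apply, smul_eq_mul,
      Finset.sum_add_distrib, ← Finset.mul_sum]
    linear_combination hab.symm
  · simp only [pcoord, Fin.snoc_castSucc]; simp

/-- minimum of a tuple -/
def mn (r : ℕ) (p : Fin (r+1) → ℝ) : ℝ := Finset.univ.inf' Finset.univ_nonempty p

theorem le_mn (r : ℕ) (p : Fin (r+1) → ℝ) (c : ℝ) : c ≤ mn r p ↔ ∀ j, c ≤ p j := by
  simp [mn]

theorem mn_le (r : ℕ) (p : Fin (r+1) → ℝ) (j) : mn r p ≤ p j := (le_mn r p _).1 le_rfl j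

theorem exists_mn (r : ℕ) (p : Fin (r+1) → ℝ) : ∃ j, mn r p = p j := by
  obtain ⟨j, _, hj⟩ := Finset.exists_mem_eq_inf' (Finset.univ_nonempty (α := Fin (r+1))) p
  exact ⟨j, hj⟩

theorem mn_cont (r : ℕ) : Continuous (mn r) := by
  unfold mn
  exact Continuous.finset_inf'_apply _ (fun i _ => continuous_apply i)

/-- the convex body -/
def KK (r : ℕ) : Set ((Fin r → ℝ) × ℂ) := {y | ‖y.2‖ ≤ mn r (pcoord r y.1)}

theorem KK_cont (r : ℕ) : Continuous fun y : (Fin r → ℝ) × ℂ => mn r (pcoord r y.1) :=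
  (mn_cont r).comp (continuous_pi fun j => (pcoord_cont r j).comp continuous_fst)

theorem KK_convex (r : ℕ) : Convex ℝ (KK r) := by
  intro x hx y hy a b ha hb hab
  simp only [KK, Set.mem_ofPred_eq, le_mn] at *
  intro j
  rw [Prod.fst_add, Prod.smul_fst, Prod.smul_fst, pcoord_aff r j _ _ a b hab]
  refine (norm_add_le _ _).trans ?_
  have h1 := mul_le_mul_of_nonneg_left (hx j) ha
  have h2 := mul_le_mul_of_nonneg_left (hy j) hb
  simp only [Prod.smul_snd, norm_smul, Real.norm_eq_abs, abs_of_nonneg ha, abs_of_nonneg hb]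
  linarith

theorem KK_closed (r : ℕ) : IsClosed (KK r) :=
  isClosed_le (continuous_snd.norm) (KK_cont r)

theorem pcoord_le_one (r : ℕ) (v : Fin r → ℝ) (h : ∀ j, 0 ≤ pcoord r v j) (j) :
    pcoord r v j ≤ 1 := by
  rw [← pcoord_sum r v]
  exact Finset.single_le_sum (fun i _ => h i) (Finset.mem_univ j)

theorem KK_bounded (r : ℕ) : Bornology.IsBounded (KK r) := by
  rw [isBounded_iff_forall_norm_le]
  refine ⟨1, fun y hy => ?_⟩
  simp only [KK, Set.mem_ofPred_eq, le_mn] at hy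
  have h0 : ∀ j, 0 ≤ pcoord r y.1 j := fun j => (norm_nonneg _).trans (hy j)
  have h1 := pcoord_le_one r y.1 h0
  refine norm_prod_le_iff.2 ⟨?_, (hy 0).trans (h1 0)⟩
  rw [pi_norm_le_iff_of_nonneg zero_le_one]
  intro i
  have h2 := h0 i.castSucc
  have h3 := h1 i.castSucc
  simp only [pcoord, Fin.snoc_castSucc] at h2 h3
  rw [Real.norm_eq_abs, abs_of_nonneg h2]; exact h3

theorem KK_sub_interior (r : ℕ) :
    {y : (Fin r → ℝ) × ℂ | ‖y.2‖ < mn r (pcoord r y.1)} ⊆ interior (KK r) :=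
  interior_maximal (fun _ h => by
    simp only [KK, Set.mem_ofPred_eq] at *; exact h.le) (isOpen_lt (continuous_snd.norm) (KK_cont r))

theorem KK_int (r : ℕ) : (interior (KK r)).Nonempty := by
  refine ⟨(fun _ => 1 / (r+1 : ℝ), 0), KK_sub_interior r ?_⟩
  obtain ⟨j, hj⟩ := exists_mn r (pcoord r fun _ => 1 / (r+1 : ℝ))
  simp only [Set.mem_ofPred_eq, norm_zero]
  rw [hj]
  have hr : (0:ℝ) < r + 1 := by positivity
  refine Fin.lastCases ?_ (fun i => ?_) j
  · simp only [pcoord, Fin.snoc_last]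
    simp
    rw [← div_eq_mul_inv, div_lt_one hr]; linarith
  · simp only [pcoord, Fin.snoc_castSucc]; positivity

theorem KK_frontier (r : ℕ) :
    frontier (KK r) = {y | ‖y.2‖ = mn r (pcoord r y.1)} := by
  rw [(KK_closed r).frontier_eq]
  ext y
  constructor
  · rintro ⟨h1, h2⟩
    exact le_antisymm h1 (not_lt.1 fun h => h2 (KK_sub_interior r h))
  · intro h
    refine ⟨le_of_eq h, fun hi => ?_⟩
    -- move outward
    obtain ⟨e, he, hey⟩ : ∃ e : ℂ, ‖e‖ = 1 ∧ ‖y.2‖ * e = y.2 := by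
      by_cases h0 : y.2 = 0
      · exact ⟨1, by simp, by simp [h0]⟩
      · have : (‖y.2‖ : ℂ) ≠ 0 := by simpa using h0
        exact ⟨y.2 / ‖y.2‖, by simp [h0], by field_simp⟩
    have hc : Continuous fun s : ℝ => (y.1, ((‖y.2‖ + s : ℝ) : ℂ) * e) := by fun_prop
    have hev : ∀ᶠ s in nhds (0:ℝ), (y.1, ((‖y.2‖ + s : ℝ) : ℂ) * e) ∈ interior (KK r) := by
      refine hc.continuousAt.eventually (isOpen_interior.mem_nhds ?_)
      simpa [hey] using hi
    have hev2 : ∀ᶠ s in nhdsWithin (0:ℝ) (Set.Ioi 0), (y.1, ((‖y.2‖ + s : ℝ) : ℂ) * e) ∈ interior (KK r) :=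
      hev.filter_mono nhdsWithin_le_nhds
    obtain ⟨s, hs, hs0⟩ := (hev2.and self_mem_nhdsWithin).exists
    have h5 := interior_subset hs
    have hs0' : 0 < s := hs0
    simp only [KK, Set.mem_ofPred_eq, norm_mul, he, mul_one, Complex.norm_real, Real.norm_eq_abs] at h5
    rw [abs_of_nonneg (by positivity)] at h5
    have : ‖y.2‖ = mn r (pcoord r y.1) := h
    linarith

theorem KK_sphere (r : ℕ) : Nonempty (
    {y : (Fin r → ℝ) × ℂ | ‖y.2‖ = mn r (pcoord r y.1)} ≃ₜ
      Metric.sphere (0 : EuclideanSpace ℝ (Fin (r + 2))) 1) := by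
  let e : ((Fin r → ℝ) × ℂ) ≃L[ℝ] EuclideanSpace ℝ (Fin (r+2)) :=
    ContinuousLinearEquiv.ofFinrankEq (by simp [Complex.finrank_real_complex])
  have hfr : frontier (e '' KK r) = e '' frontier (KK r) :=
    (e.toHomeomorph.image_frontier (KK r)).symm
  have hint : interior (e '' KK r) = e '' interior (KK r) :=
    (e.toHomeomorph.image_interior (KK r)).symm
  obtain ⟨h, -, -, hh⟩ := exists_homeomorph_image_interior_closure_frontier_eq_unitBall
    (s := e '' KK r) ((KK_convex r).linear_image e.toLinearEquiv.toLinearMap)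
    (by rw [hint]; exact (KK_int r).image _)
    (by
      have hcomp : IsCompact (KK r) := Metric.isCompact_of_isClosed_isBounded (KK_closed r) (KK_bounded r)
      exact (hcomp.image e.continuous).isBounded)
  rw [hfr, KK_frontier] at hh
  have hh' : (e.toHomeomorph.trans h) '' {y | ‖y.2‖ = mn r (pcoord r y.1)} = Metric.sphere 0 1 := by
    rw [← hh, Set.image_image]; rfl
  exact ⟨((e.toHomeomorph.trans h).image _).trans (Homeomorph.setCongr hh')⟩

/-- power or conjugate power -/
def cj (a : ℤ) (x : ℂ) : ℂ :=
  if 0 ≤ a then x ^ a.natAbs else (starRingEnd ℂ x) ^ a.natAbs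

theorem cj_cont (a : ℤ) : Continuous (cj a) := by
  unfold cj
  split_ifs
  · fun_prop
  · exact (Complex.continuous_conj).pow _

theorem cj_norm (a : ℤ) (x : ℂ) : ‖cj a x‖ = ‖x‖ ^ a.natAbs := by
  unfold cj
  split_ifs <;> simp

theorem cj_mul (a : ℤ) (u : Circle) (x : ℂ) : cj a (u * x) = (u ^ a : Circle) * cj a x := by
  unfold cj
  split_ifs with h
  · rw [mul_pow]
    congr 1
    obtain ⟨m, rfl⟩ := Int.eq_ofNat_of_zero_le h
    simp
  · rw [map_mul, mul_pow]
    congr 1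
    obtain ⟨m, hm⟩ := Int.eq_ofNat_of_zero_le (a := -a) (by omega)
    obtain rfl : a = -(m : ℤ) := by omega
    rw [← Circle.coe_inv_eq_conj]
    simp

theorem cj_ofReal (a : ℤ) (x : ℝ) : cj a x = ((x ^ a.natAbs : ℝ) : ℂ) := by
  unfold cj
  split_ifs <;> simp

/-- the invariant monomial -/
def FF {r : ℕ} (a : Fin (r+1) → ℤ) (x : Fin (r+1) → ℂ) : ℂ := ∏ j, cj (a j) (x j)

theorem FF_cont {r : ℕ} (a : Fin (r+1) → ℤ) : Continuous (FF a) :=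
  continuous_finsetProd _ fun j _ => (cj_cont _).comp (continuous_apply j)

theorem FF_norm {r : ℕ} (a : Fin (r+1) → ℤ) (x) : ‖FF a x‖ = ∏ j, ‖x j‖ ^ (a j).natAbs := by
  simp [FF, norm_prod, cj_norm]

theorem FF_mul {r : ℕ} (a : Fin (r+1) → ℤ) (u : Fin (r+1) → Circle) (x : Fin (r+1) → ℂ) :
    FF a (fun j => u j * x j) = ((∏ j, u j ^ a j : Circle) : ℂ) * FF a x := by
  simp only [FF, cj_mul, Finset.prod_mul_distrib]
  congr 1
  exact (map_prod Circle.coeHom (fun j => u j ^ a j) Finset.univ).symm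

theorem FF_eq_zero {r : ℕ} (a : Fin (r+1) → ℤ) (ha : ∀ j, a j ≠ 0) (x : Fin (r+1) → ℂ) :
    FF a x = 0 ↔ ∃ j, x j = 0 := by
  rw [← norm_eq_zero, FF_norm, Finset.prod_eq_zero_iff]
  simp [ha]

/-- second component -/
def WW {r : ℕ} (a : Fin (r+1) → ℤ) (x : Fin (r+1) → ℂ) : ℂ :=
  (mn r (fun j => ‖x j‖ ^ 2) : ℂ) * (FF a x / ‖FF a x‖)

theorem mn_nonneg {r : ℕ} (x : Fin (r+1) → ℂ) : 0 ≤ mn r (fun j => ‖x j‖ ^ 2) :=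
  (le_mn _ _ _).2 fun j => by positivity

theorem mn_zero {r : ℕ} (x : Fin (r+1) → ℂ) (h : ∃ j, x j = 0) : mn r (fun j => ‖x j‖ ^ 2) = 0 := by
  obtain ⟨j, hj⟩ := h
  refine le_antisymm ?_ (mn_nonneg x)
  refine (mn_le r _ j).trans ?_
  simp [hj]

theorem mn_pos {r : ℕ} (x : Fin (r+1) → ℂ) (h : ∀ j, x j ≠ 0) : 0 < mn r (fun j => ‖x j‖ ^ 2) := by
  obtain ⟨j, hj⟩ := exists_mn r (fun j => ‖x j‖ ^ 2)
  rw [hj]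
  have := norm_pos_iff.2 (h j)
  positivity

theorem WW_norm {r : ℕ} (a : Fin (r+1) → ℤ) (ha : ∀ j, a j ≠ 0) (x : Fin (r+1) → ℂ) :
    ‖WW a x‖ = mn r (fun j => ‖x j‖ ^ 2) := by
  by_cases h : ∃ j, x j = 0
  · simp [WW, mn_zero x h]
  · have : FF a x ≠ 0 := fun h0 => h ((FF_eq_zero a ha x).1 h0)
    simp [WW, abs_of_nonneg (mn_nonneg x), this]

theorem mnx_cont (r : ℕ) : Continuous fun x : Fin (r+1) → ℂ => mn r (fun j => ‖x j‖ ^ 2) :=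
  (mn_cont r).comp (by fun_prop)

theorem WW_cont {r : ℕ} (a : Fin (r+1) → ℤ) (ha : ∀ j, a j ≠ 0) : Continuous (WW a) := by
  rw [continuous_iff_continuousAt]
  intro x
  by_cases h : FF a x = 0
  · have h0 := mn_zero x ((FF_eq_zero a ha x).1 h)
    have hW : WW a x = 0 := by rw [← norm_eq_zero, WW_norm a ha, h0]
    rw [ContinuousAt, hW, tendsto_zero_iff_norm_tendsto_zero]
    simp_rw [WW_norm a ha]
    have := (mnx_cont r).tendsto x
    rwa [h0] at this
  · unfold WW
    have h1 : (‖FF a x‖ : ℂ) ≠ 0 := by simpa using h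
    refine ContinuousAt.mul ?_ (ContinuousAt.div ?_ ?_ h1)
    · exact (Complex.continuous_ofReal.comp (mnx_cont r)).continuousAt
    · exact (FF_cont a).continuousAt
    · exact (Complex.continuous_ofReal.comp (FF_cont a).norm).continuousAt

theorem FF_eq_of_WW {r : ℕ} (a : Fin (r+1) → ℤ) (x y : Fin (r+1) → ℂ)
    (hx : ∀ j, x j ≠ 0) (hn : ∀ j, ‖x j‖ = ‖y j‖) (h : WW a x = WW a y) : FF a x = FF a y := by
  have h1 : ‖FF a x‖ = ‖FF a y‖ := by simp [FF_norm, hn]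
  have h2 : (mn r (fun j => ‖x j‖ ^ 2) : ℂ) ≠ 0 := by exact_mod_cast (mn_pos x hx).ne'
  unfold WW at h
  simp_rw [← hn, ← h1] at h
  have h3 := mul_left_cancel₀ h2 h
  by_cases h4 : FF a x = 0
  · rw [h4, norm_zero] at h1
    rw [h4, norm_eq_zero.1 h1.symm]
  · have h5 : (‖FF a x‖ : ℂ) ≠ 0 := by simpa using h4
    field_simp at h3
    exact h3

theorem exists_circle (x y : ℂ) (h : ‖x‖ = ‖y‖) : ∃ u : Circle, (u : ℂ) * x = y := by
  by_cases hx : x = 0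
  · subst hx
    refine ⟨1, ?_⟩
    rw [norm_zero] at h
    rw [mul_zero, norm_eq_zero.1 h.symm]
  · refine ⟨⟨y / x, ?_⟩, ?_⟩
    · rw [Submonoid.unitSphere, ← SetLike.mem_coe]
      change y / x ∈ Metric.sphere (0:ℂ) 1
      rw [mem_sphere_zero_iff_norm, norm_div, ← h, div_self (by simpa using hx)]
    · field_simp

theorem prod_update {r : ℕ} (a : Fin (r+1) → ℤ) (u : Fin (r+1) → Circle) (k) (ha : a k ≠ 0) (c : Circle) :
    ∃ s : Circle, ∏ j, Function.update u k s j ^ a j = c := by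
  obtain ⟨s, hs⟩ := circle_root (a k) ha (c * (∏ j ∈ Finset.univ.erase k, u j ^ a j)⁻¹)
  refine ⟨s, ?_⟩
  rw [← Finset.mul_prod_erase _ _ (Finset.mem_univ k), Function.update_self, hs]
  have : ∏ j ∈ Finset.univ.erase k, Function.update u k s j ^ a j
      = ∏ j ∈ Finset.univ.erase k, u j ^ a j := Finset.prod_congr rfl fun j hj => by
    rw [Function.update_of_ne (Finset.ne_of_mem_erase hj)]
  rw [this, inv_mul_cancel_right]

theorem exists_u {r : ℕ} (a : Fin (r+1) → ℤ) (ha : ∀ j, a j ≠ 0) (x y : Fin (r+1) → ℂ)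
    (hn : ∀ j, ‖x j‖ = ‖y j‖) (h : WW a x = WW a y) :
    ∃ u : Fin (r+1) → Circle, ∏ j, u j ^ a j = 1 ∧ ∀ j, (u j : ℂ) * x j = y j := by
  choose u hu using fun j => exists_circle (x j) (y j) (hn j)
  by_cases h0 : ∃ k, x k = 0
  · obtain ⟨k, hk⟩ := h0
    obtain ⟨s, hs⟩ := prod_update a u k (ha k) 1
    refine ⟨_, hs, fun j => ?_⟩
    by_cases hj : j = k
    · subst hj
      have := hu j
      rw [hk, mul_zero] at this ⊢
      exact this
    · rw [Function.update_of_ne hj, hu]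
  · push Not at h0
    refine ⟨u, ?_, hu⟩
    have h1 := FF_eq_of_WW a x y h0 hn h
    have h2 := FF_mul a u x
    simp_rw [hu] at h2
    have h3 : FF a x ≠ 0 := fun h => by
      obtain ⟨j, hj⟩ := (FF_eq_zero a ha x).1 h
      exact h0 j hj
    change FF a y = _ at h2
    rw [← h1] at h2
    have h4 : ((∏ j, u j ^ a j : Circle) : ℂ) = 1 := by
      have : (1 - ((∏ j, u j ^ a j : Circle) : ℂ)) * FF a x = 0 := by linear_combination h2
      rcases mul_eq_zero.1 this with h | h
      · linear_combination -h
      · exact absurd h h3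
    exact Circle.ext (by simpa using h4)

theorem exists_x {r : ℕ} (a : Fin (r+1) → ℤ) (ha : ∀ j, a j ≠ 0) (p : Fin (r+1) → ℝ) (w : ℂ)
    (h : ‖w‖ = mn r p) : ∃ x : Fin (r+1) → ℂ, (∀ j, ‖x j‖ ^ 2 = p j) ∧ WW a x = w := by
  have hp : ∀ j, 0 ≤ p j := (le_mn r p 0).1 (h ▸ norm_nonneg w)
  let x0 : Fin (r+1) → ℂ := fun j => (Real.sqrt (p j) : ℂ)
  have hx0 : ∀ j, ‖x0 j‖ ^ 2 = p j := fun j => by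
    simp [x0, abs_of_nonneg, hp j]
  obtain ⟨c, hc⟩ : ∃ c : Circle, (c : ℂ) * ‖w‖ = w := exists_circle _ _ (by simp)
  obtain ⟨s, hs⟩ := prod_update a 1 0 (ha 0) c
  let x : Fin (r+1) → ℂ := fun j => (Function.update (1 : Fin (r+1) → Circle) 0 s j : ℂ) * x0 j
  have hx : ∀ j, ‖x j‖ ^ 2 = p j := fun j => by simp only [x, norm_mul, Circle.norm_coe, one_mul, hx0]
  refine ⟨x, hx, ?_⟩
  have hF : FF a x = c * FF a x0 := by rw [← hs]; exact FF_mul a _ x0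
  by_cases hw : w = 0
  · rw [hw, ← norm_eq_zero, WW_norm a ha]
    simp_rw [hx]
    rw [← h, hw, norm_zero]
  · have hpos : ∀ j, 0 < p j := fun j => (norm_pos_iff.2 hw).trans_le (h ▸ mn_le r p j)
    have hF0 : FF a x0 = ((∏ j, Real.sqrt (p j) ^ (a j).natAbs : ℝ) : ℂ) := by
      simp only [FF, x0, cj_ofReal]
      push_cast; rfl
    have hP : 0 < ∏ j, Real.sqrt (p j) ^ (a j).natAbs :=
      Finset.prod_pos fun j _ => pow_pos (Real.sqrt_pos.2 (hpos j)) _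
    unfold WW
    simp_rw [hx]
    rw [hF, hF0, ← h, norm_mul, Circle.norm_coe, one_mul, Complex.norm_real, Real.norm_eq_abs,
      abs_of_pos hP, mul_div_assoc, div_self (by exact_mod_cast hP.ne'), mul_one, mul_comm, hc]

theorem sph_sum {n : ℕ} (x : Sph n) : ∑ j, ‖(x : EuclideanSpace ℂ (Fin n)) j‖ ^ 2 = 1 := by
  rw [← EuclideanSpace.norm_sq_eq]
  have := x.2
  rw [mem_sphere_zero_iff_norm] at this
  rw [this]; norm_num

theorem pcoord_of_sum {r : ℕ} (p : Fin (r+1) → ℝ) (h : ∑ j, p j = 1) :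
    pcoord r (fun i => p i.castSucc) = p := by
  rw [Fin.sum_univ_castSucc] at h
  ext j
  refine Fin.lastCases ?_ (fun i => ?_) j
  · simp only [pcoord, Fin.snoc_last]; linarith
  · simp only [pcoord, Fin.snoc_castSucc]

theorem orbitSpace_circuit_homeomorph_sphere (r : ℕ) (hr : 1 ≤ r)
    (z : Fin r → Fin (r + 1) → ℤ)
    (heff : Submodule.span ℤ (Set.range fun j => fun i => z i j) = ⊤)
    (hind : ∀ s : Finset (Fin (r + 1)), s.card = r →
      LinearIndependent ℚ (fun j : s => fun i => (z i (j : Fin (r + 1)) : ℚ))) :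
    Nonempty (OrbitSpace z ≃ₜ Metric.sphere (0 : EuclideanSpace ℝ (Fin (r + 2))) 1) := by
  obtain ⟨a, ha, h1, h2⟩ := alg r z heff hind
  obtain ⟨H⟩ := KK_sphere r
  let Y := {y : (Fin r → ℝ) × ℂ | ‖y.2‖ = mn r (pcoord r y.1)}
  let co : Sph (r+1) → Fin (r+1) → ℂ := fun x j => (x : EuclideanSpace ℂ (Fin (r+1))) j
  have hco : Continuous co := by fun_prop
  have hpc : ∀ x, pcoord r (fun i => ‖co x i.castSucc‖ ^ 2) = fun j => ‖co x j‖ ^ 2 := fun x =>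
    pcoord_of_sum (fun j => ‖co x j‖ ^ 2) (sph_sum x)
  let Φ : Sph (r+1) → Y := fun x => ⟨(fun i => ‖co x i.castSucc‖ ^ 2, WW a (co x)), by
    change ‖WW a (co x)‖ = mn r (pcoord r _)
    rw [hpc, WW_norm a ha]⟩
  have hΦ : Continuous Φ := by
    refine Continuous.subtype_mk (Continuous.prodMk ?_ ((WW_cont a ha).comp hco)) _
    fun_prop
  have hinv : ∀ x y, (orbitSetoid z).r x y → Φ x = Φ y := by
    rintro x y ⟨t, ht⟩
    have hy : co y = fun j => (weightProd z t j : ℂ) * co x j := funext fun j => (ht j).symm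
    have hn : ∀ j, ‖co y j‖ = ‖co x j‖ := fun j => by
      rw [hy, norm_mul, Circle.norm_coe, one_mul]
    have hF : FF a (co y) = FF a (co x) := by rw [hy, FF_mul, h1]; simp
    apply Subtype.ext
    simp only [Φ, WW, hn, hF]
  have hinj : ∀ x y, Φ x = Φ y → (orbitSetoid z).r x y := by
    intro x y h
    have h3 := congrArg Subtype.val h
    have h4 : (fun i : Fin r => ‖co x i.castSucc‖ ^ 2) = fun i => ‖co y i.castSucc‖ ^ 2 :=
      congrArg Prod.fst h3
    have h5 : WW a (co x) = WW a (co y) := congrArg Prod.snd h3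
    have h6 : (fun j => ‖co x j‖ ^ 2) = fun j => ‖co y j‖ ^ 2 := by
      rw [← hpc, ← hpc, h4]
    have h7 : ∀ j, ‖co x j‖ = ‖co y j‖ := fun j =>
      (sq_eq_sq₀ (norm_nonneg _) (norm_nonneg _)).1 (congrFun h6 j)
    obtain ⟨u, hu, hxy⟩ := exists_u a ha _ _ h7 h5
    obtain ⟨t, ht⟩ := h2 u hu
    exact ⟨t, fun j => by rw [ht]; exact hxy j⟩
  have hsurj : Function.Surjective Φ := by
    rintro ⟨⟨v, w⟩, hy⟩
    obtain ⟨x, hx, hw⟩ := exists_x a ha (pcoord r v) w hy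
    refine ⟨⟨WithLp.toLp 2 x, ?_⟩, ?_⟩
    · rw [mem_sphere_zero_iff_norm, ← sq_eq_sq₀ (norm_nonneg _) zero_le_one,
        EuclideanSpace.norm_sq_eq]
      simp [hx, pcoord_sum]
    · apply Subtype.ext
      refine Prod.ext ?_ hw
      ext i
      change ‖x i.castSucc‖ ^ 2 = v i
      rw [hx]; simp [pcoord]
  let Ψ : OrbitSpace z → Y := Quotient.lift Φ hinv
  have hΨ : Continuous Ψ := hΦ.quotient_lift hinv
  have hbij : Function.Bijective Ψ := by
    constructor
    · intro p q
      induction p using Quotient.inductionOn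
      induction q using Quotient.inductionOn
      intro h
      exact Quotient.sound (hinj _ _ h)
    · intro y
      obtain ⟨x, hx⟩ := hsurj y
      exact ⟨Quotient.mk _ x, hx⟩
  have hΨ' : Continuous (Equiv.ofBijective Ψ hbij) := hΨ
  exact ⟨hΨ'.homeoOfEquivCompactToT2.trans H⟩
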